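/- Let 1 ≤ k < n be integers. Then H({g ∈ O(n) : g E_k ∩ F_{n-k} ≠ ∅}) = 2 · σ_{n-k}(C_1(F_{n-k})); that is, the probability that a random k-dimensional subspace of ℝ^n meets the face F_{n-k} of the cube equals twice the normalized (n−k)-dimensional measure of the spherical cap C_1(F_{n-k}) cut out on S^{n-1} by the cone generated by F_{n-k}. -/

import Mathlib

open MeasureTheory Filter Real

noncomputable section

/-- The orthogonal group O(n) of ℝⁿ. -/
abbrev OG (n : ℕ) : Type := Matrix.orthogonalGroup (Fin n) ℝ

instance (n : ℕ) : MeasurableSpace (OG n) := borel _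
instance (n : ℕ) : BorelSpace (OG n) := ⟨rfl⟩

/-- The natural action of `g ∈ O(n)` on `ℝⁿ`. -/
def act {n : ℕ} (g : OG n) (x : EuclideanSpace ℝ (Fin n)) : EuclideanSpace ℝ (Fin n) :=
  Matrix.toEuclideanLin (g : Matrix (Fin n) (Fin n) ℝ) x

/-- `E_k`: the span of the first `k` standard basis vectors of `ℝⁿ`, as a set. -/
def Ek (n k : ℕ) : Set (EuclideanSpace ℝ (Fin n)) :=
  {x | ∀ i : Fin n, k ≤ (i : ℕ) → x i = 0}

/-- The `m`-dimensional face `{x : |xᵢ| ≤ 1 for i < m, xᵢ = 1 for i ≥ m}` of the cube `[-1,1]ⁿ`. -/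
def cubeFace (n m : ℕ) : Set (EuclideanSpace ℝ (Fin n)) :=
  {x | (∀ i : Fin n, (i : ℕ) < m → |x i| ≤ 1) ∧ ∀ i : Fin n, m ≤ (i : ℕ) → x i = 1}

/-- `f(j,k,n)`, the expected number of `j`-faces of a random `k`-section of the `n`-cube,
computed with respect to the probability measure `H` on `O(n)`. -/
def expFaces (n : ℕ) (H : Measure (OG n)) (j k : ℕ) : ℝ :=
  2 ^ (k - j) * (n.choose (k - j)) *
    (H {g | (act g '' Ek n k ∩ cubeFace n (n - k + j)).Nonempty}).toReal

/-- `H^p(S^p)`: the `p`-dimensional Hausdorff measure of the unit sphere `S^p ⊆ ℝ^{p+1}`. -/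
def sphereHaus (p : ℕ) : ENNReal :=
  (μH[(p : ℝ)] : Measure (EuclideanSpace ℝ (Fin (p + 1)))) (Metric.sphere 0 1)

/-- `σ_p(S) = H^p(S) / H^p(S^p)`, the normalized `p`-dimensional spherical measure. -/
def sigmaMeas (p : ℕ) {n : ℕ} (S : Set (EuclideanSpace ℝ (Fin n))) : ENNReal :=
  μH[(p : ℝ)] S / sphereHaus p

/-- `C(F) = {t·x : x ∈ F, t ≥ 0}`, the cone generated by `F`. -/
def coneOf {n : ℕ} (F : Set (EuclideanSpace ℝ (Fin n))) : Set (EuclideanSpace ℝ (Fin n)) :=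
  {y | ∃ x ∈ F, ∃ t : ℝ, 0 ≤ t ∧ y = t • x}

/-- `C₁(F) = C(F) ∩ S^{n-1}`. -/
def coneSphere {n : ℕ} (F : Set (EuclideanSpace ℝ (Fin n))) : Set (EuclideanSpace ℝ (Fin n)) :=
  coneOf F ∩ Metric.sphere 0 1


open Matrix in
lemma og_orthonormal {n : ℕ} (b : Fin n → EuclideanSpace ℝ (Fin n)) (hb : Orthonormal ℝ b) :
    (Matrix.of fun i j => b j i) ∈ Matrix.orthogonalGroup (Fin n) ℝ := by
  rw [Matrix.mem_orthogonalGroup_iff']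
  ext i j
  have := (orthonormal_iff_ite.1 hb) i j
  rw [Matrix.mul_apply, Matrix.one_apply, ← this, PiLp.inner_apply]
  simp [mul_comm]

instance og_sc (n : ℕ) : SecondCountableTopology (OG n) := by
  have : SecondCountableTopology (Matrix (Fin n) (Fin n) ℝ) :=
    inferInstanceAs (SecondCountableTopology (Fin n → Fin n → ℝ))
  exact Topology.IsInducing.subtypeVal.secondCountableTopology

instance og_compact (n : ℕ) : CompactSpace (OG n) := by
  refine isCompact_iff_compactSpace.1 (?_ : IsCompact
    ((Matrix.orthogonalGroup (Fin n) ℝ : Submonoid _) : Set (Matrix (Fin n) (Fin n) ℝ)))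
  have hc : IsCompact (Set.pi Set.univ fun _ : Fin n => Set.pi Set.univ fun _ : Fin n =>
      Set.Icc (-1:ℝ) 1) :=
    isCompact_univ_pi fun _ => isCompact_univ_pi fun _ => isCompact_Icc
  refine IsCompact.of_isClosed_subset (X := Matrix (Fin n) (Fin n) ℝ) hc ?_ ?_
  · have : ((Matrix.orthogonalGroup (Fin n) ℝ : Submonoid _) : Set (Matrix (Fin n) (Fin n) ℝ)) =
        {A | A * Matrix.transpose A = 1} := by
      ext A; exact Matrix.mem_orthogonalGroup_iff _ _
    rw [this]
    exact isClosed_eq (by fun_prop) continuous_const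
  · intro A hA i _ j _
    have := entry_norm_bound_of_unitary hA i j
    rwa [Real.norm_eq_abs, abs_le] at this

lemma act_apply {n : ℕ} (g : OG n) (x : EuclideanSpace ℝ (Fin n)) (i : Fin n) :
    act g x i = ∑ j, (g : Matrix _ _ ℝ) i j * x j := by
  simp [act, Matrix.toLpLin_apply, Matrix.mulVec, dotProduct]

lemma act_mul {n : ℕ} (g h : OG n) (x : EuclideanSpace ℝ (Fin n)) :
    act (g * h) x = act g (act h x) := by
  simp [act, Matrix.toLpLin_apply]

lemma act_one {n : ℕ} (x : EuclideanSpace ℝ (Fin n)) :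
    act (1 : OG n) x = x := by
  simp [act, Matrix.toLpLin_apply]

lemma act_inv_act {n : ℕ} (g : OG n) (x : EuclideanSpace ℝ (Fin n)) :
    act g⁻¹ (act g x) = x := by
  rw [← act_mul, inv_mul_cancel, act_one]

lemma act_act_inv {n : ℕ} (g : OG n) (x : EuclideanSpace ℝ (Fin n)) :
    act g (act g⁻¹ x) = x := by
  rw [← act_mul, mul_inv_cancel, act_one]

lemma act_smul {n : ℕ} (g : OG n) (t : ℝ) (x : EuclideanSpace ℝ (Fin n)) :
    act g (t • x) = t • act g x := by
  simp [act]

lemma act_neg {n : ℕ} (g : OG n) (x : EuclideanSpace ℝ (Fin n)) :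
    act g (- x) = - act g x := by
  simp [act]

lemma act_sub {n : ℕ} (g : OG n) (x y : EuclideanSpace ℝ (Fin n)) :
    act g (x - y) = act g x - act g y := by
  simp [act]

lemma og_inv_coe {n : ℕ} (g : OG n) :
    ((g⁻¹ : OG n) : Matrix (Fin n) (Fin n) ℝ) = Matrix.transpose (g : Matrix (Fin n) (Fin n) ℝ) := rfl

lemma og_mul_coe {n : ℕ} (g h : OG n) :
    ((g * h : OG n) : Matrix (Fin n) (Fin n) ℝ) = (g : Matrix (Fin n) (Fin n) ℝ) * h := rfl

lemma act_norm {n : ℕ} (g : OG n) (x : EuclideanSpace ℝ (Fin n)) : ‖act g x‖ = ‖x‖ := by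
  have h : Matrix.transpose (g : Matrix (Fin n) (Fin n) ℝ) * (g : Matrix (Fin n) (Fin n) ℝ) = 1 :=
    (Matrix.mem_orthogonalGroup_iff' _ _).1 g.2
  have key : ∀ y : EuclideanSpace ℝ (Fin n), ‖y‖ ^ 2 = dotProduct y.ofLp y.ofLp := by
    intro y
    rw [EuclideanSpace.real_norm_sq_eq]
    simp [dotProduct, sq]
  rw [← sq_eq_sq₀ (norm_nonneg _) (norm_nonneg _), key, key]
  simp only [act, Matrix.toLpLin_apply]
  rw [Matrix.dotProduct_mulVec, Matrix.vecMul_mulVec, h, Matrix.vecMul_one]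

lemma act_isometry {n : ℕ} (g : OG n) : Isometry (act g) :=
  Isometry.of_dist_eq fun x y => by rw [dist_eq_norm, dist_eq_norm, ← act_sub, act_norm]

lemma act_continuous (n : ℕ) :
    Continuous fun p : OG n × EuclideanSpace ℝ (Fin n) => act p.1 p.2 := by
  refine (PiLp.continuous_toLp 2 _).comp
    (f := fun p : OG n × EuclideanSpace ℝ (Fin n) => (p.1 : Matrix (Fin n) (Fin n) ℝ).mulVec p.2.ofLp) ?_
  have h1 : Continuous fun p : OG n × EuclideanSpace ℝ (Fin n) => (p.1 : Matrix (Fin n) (Fin n) ℝ) :=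
    continuous_subtype_val.comp continuous_fst
  have h2 : Continuous fun p : OG n × EuclideanSpace ℝ (Fin n) => p.2.ofLp :=
    (PiLp.continuous_ofLp 2 _).comp continuous_snd
  exact h1.matrix_mulVec h2

lemma og_trans {n : ℕ} (x v : EuclideanSpace ℝ (Fin n)) (h : ‖v‖ = ‖x‖) :
    ∃ g : OG n, act g v = x := by
  let f := (ℝ ∙ (v - x))ᗮ.reflection
  have hf : f v = x := Submodule.reflection_sub h
  let b : OrthonormalBasis (Fin n) ℝ (EuclideanSpace ℝ (Fin n)) :=
    (EuclideanSpace.basisFun (Fin n) ℝ).map f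
  refine ⟨⟨_, og_orthonormal b b.orthonormal⟩, ?_⟩
  rw [← hf]
  ext i
  rw [act_apply]
  conv_rhs => rw [← (EuclideanSpace.basisFun (Fin n) ℝ).sum_repr v]
  simp [b, mul_comm]

lemma act_continuous_comp {Y : Type*} [TopologicalSpace Y] {n : ℕ} {u : Y → OG n}
    {w : Y → EuclideanSpace ℝ (Fin n)} (hu : Continuous u) (hw : Continuous w) :
    Continuous fun y => act (u y) (w y) := by
  have h1 : Continuous fun y => (u y : Matrix (Fin n) (Fin n) ℝ) :=
    continuous_subtype_val.comp hu
  have h2 : Continuous fun y => (w y).ofLp :=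
    (PiLp.continuous_ofLp 2 _).comp hw
  have h3 : Continuous fun y => (u y : Matrix (Fin n) (Fin n) ℝ).mulVec (w y).ofLp :=
    h1.matrix_mulVec h2
  exact (PiLp.continuous_toLp 2 (fun _ : Fin n => ℝ)).comp h3

lemma og_continuous_inv (n : ℕ) : Continuous fun g : OG n => g⁻¹ := continuous_inv

/-- uniform distribution -/
lemma unif {m : ℕ} (κ : Measure (OG (m+1))) [κ.IsMulLeftInvariant] [IsProbabilityMeasure κ]
    (hfin : sphereHaus m ≠ ⊤)
    (A : Set (EuclideanSpace ℝ (Fin (m+1)))) (hA : MeasurableSet A) (hAS : A ⊆ Metric.sphere 0 1)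
    (v : EuclideanSpace ℝ (Fin (m+1))) (hv : ‖v‖ = 1) :
    κ {h | act h⁻¹ v ∈ A} * sphereHaus m = μH[(m:ℝ)] A := by
  let μ : Measure (EuclideanSpace ℝ (Fin (m+1))) := (μH[(m:ℝ)]).restrict (Metric.sphere 0 1)
  have hfi : IsFiniteMeasure μ := ⟨by
    rw [Measure.restrict_apply_univ]; rw [sphereHaus] at hfin; exact lt_top_iff_ne_top.2 hfin⟩
  let T : Set (OG (m+1) × EuclideanSpace ℝ (Fin (m+1))) := {p | act p.1⁻¹ p.2 ∈ A}
  have hc : Continuous fun p : OG (m+1) × EuclideanSpace ℝ (Fin (m+1)) => act p.1⁻¹ p.2 :=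
    act_continuous_comp ((og_continuous_inv (m+1)).comp continuous_fst) continuous_snd
  have hT : MeasurableSet T := hc.measurable hA
  have e1 : (κ.prod μ) T = μH[(m:ℝ)] A := by
    rw [Measure.prod_apply hT]
    have : ∀ h : OG (m+1), μ (Prod.mk h ⁻¹' T) = μH[(m:ℝ)] A := by
      intro h
      have : Prod.mk h ⁻¹' T = act h '' A := by
        ext x
        simp only [T, Set.mem_preimage, Set.mem_ofPred_eq, Set.mem_image]
        constructor
        · intro hx; exact ⟨_, hx, act_act_inv h x⟩
        · rintro ⟨y, hy, rfl⟩; rwa [act_inv_act]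
      have h2 : act h '' A ⊆ Metric.sphere 0 1 := by
        rintro _ ⟨y, hy, rfl⟩
        have := hAS hy
        simp only [mem_sphere_iff_norm, sub_zero] at this ⊢
        rw [act_norm, this]
      rw [this, Measure.restrict_apply' (Metric.isClosed_sphere.measurableSet),
        Set.inter_eq_left.2 h2, (act_isometry h).hausdorffMeasure_image (Or.inl (by positivity))]
    simp [this]
  rw [← e1, Measure.prod_apply_symm hT]
  have : ∀ x ∈ Metric.sphere (0 : EuclideanSpace ℝ (Fin (m+1))) 1,
      κ ((fun h => (h, x)) ⁻¹' T) = κ {h | act h⁻¹ v ∈ A} := by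
    intro x hx
    simp only [mem_sphere_iff_norm, sub_zero] at hx
    obtain ⟨g, rfl⟩ := og_trans x v (by rw [hx, hv])
    rw [← measure_preimage_mul κ g⁻¹ {h | act h⁻¹ v ∈ A}]
    congr 1
    ext h
    simp [T, act_mul]
  rw [setLIntegral_congr_fun Metric.isClosed_sphere.measurableSet this, lintegral_const,
    Measure.restrict_apply_univ, sphereHaus]

/-- zero set of a function polynomial along lines is null -/
lemma null_zero {n : ℕ} (f : (Fin n → Fin n → ℝ) → ℝ) (hf : Continuous f)
    (x0 : Fin n → Fin n → ℝ) (h0 : f x0 ≠ 0)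
    (hp : ∀ x, ∃ p : Polynomial ℝ, ∀ t : ℝ, f (x0 + t • x) = p.eval t) :
    volume {x | f x = 0} = 0 := by
  let T : Set (ℝ × (Fin n → Fin n → ℝ)) := {q | f (x0 + q.1 • q.2) = 0}
  have hT : MeasurableSet T := by
    apply IsClosed.measurableSet
    exact isClosed_eq (by fun_prop) continuous_const
  have e1 : ((volume : Measure ℝ).prod (volume : Measure (Fin n → Fin n → ℝ))) T = 0 := by
    rw [Measure.prod_apply_symm hT, lintegral_eq_zero_iff (measurable_measure_prodMk_right hT)]
    refine Filter.Eventually.of_forall fun x => ?_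
    obtain ⟨p, hp⟩ := hp x
    have hp0 : p ≠ 0 := by
      rintro rfl
      apply h0
      simpa using hp 0
    have : (fun t => (t, x)) ⁻¹' T = {t | p.IsRoot t} := by
      ext t; simp [T, hp]
    show volume ((fun t => (t, x)) ⁻¹' T) = 0
    rw [this]
    exact (Polynomial.finite_setOfPred_isRoot hp0).measure_zero _
  have e2 := Measure.ae_ae_of_ae_prod (p := fun q => q ∉ T) (μ := (volume : Measure ℝ))
    (ν := (volume : Measure (Fin n → Fin n → ℝ))) (by
      rw [ae_iff]; simpa using e1)
  have e3 : ∀ᵐ t : ℝ, t ≠ 0 := by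
    rw [ae_iff]; simp
  obtain ⟨t, ht, ht0⟩ := (e2.and e3).exists
  rw [ae_iff] at ht
  have : {x | ¬ (t, x) ∉ T} = (fun x => t • x) ⁻¹' ((fun x => x0 + x) ⁻¹' {x | f x = 0}) := by
    ext x; simp [T]
  rw [this, Measure.addHaar_preimage_smul _ ht0, measure_preimage_add] at ht
  rcases mul_eq_zero.1 ht with h | h
  · exfalso
    rw [ENNReal.ofReal_eq_zero] at h
    exact absurd h (not_le.2 (by positivity))
  · exact h

lemma og_det_ae {n m : ℕ} (hm : m ≤ n) (H : Measure (OG n)) [H.IsMulLeftInvariant]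
    [IsProbabilityMeasure H]
    (r : Fin m → Fin n) (hr : Function.Injective r) :
    ∀ᵐ g : OG n ∂H, ((Matrix.transpose (g : Matrix (Fin n) (Fin n) ℝ)).submatrix r (Fin.castLE hm)).det ≠ 0 := by
  classical
  let c : Fin m → Fin n := Fin.castLE hm
  have hcinj : Function.Injective c := Fin.castLE_injective hm
  let F : OG n → (Fin n → Fin n → ℝ) → ℝ := fun g X =>
    ((Matrix.transpose (g : Matrix (Fin n) (Fin n) ℝ) * Matrix.of X).submatrix r c).det
  have hFc : Continuous fun p : OG n × (Fin n → Fin n → ℝ) => F p.1 p.2 := by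
    have h1 : Continuous fun p : OG n × (Fin n → Fin n → ℝ) => (p.1 : Matrix (Fin n) (Fin n) ℝ) :=
      continuous_subtype_val.comp continuous_fst
    have h2 : Continuous fun p : OG n × (Fin n → Fin n → ℝ) => Matrix.of p.2 := continuous_snd
    exact ((h1.matrix_transpose.matrix_mul h2).matrix_submatrix r c).matrix_det
  let T : Set (OG n × (Fin n → Fin n → ℝ)) := {p | F p.1 p.2 = 0}
  have hT : MeasurableSet T := (isClosed_eq hFc continuous_const).measurableSet
  have e1 : (H.prod (volume : Measure (Fin n → Fin n → ℝ))) T = 0 := by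
    rw [Measure.prod_apply hT, lintegral_eq_zero_iff (measurable_measure_prodMk_left hT)]
    refine Filter.Eventually.of_forall fun g => ?_
    show volume {X | F g X = 0} = 0
    let B : Matrix (Fin n) (Fin n) ℝ := Matrix.of fun i j => if ∃ a, r a = i ∧ c a = j then 1 else 0
    have hg : Matrix.transpose (g : Matrix (Fin n) (Fin n) ℝ) * (g : Matrix (Fin n) (Fin n) ℝ) = 1 :=
      (Matrix.mem_orthogonalGroup_iff' _ _).1 g.2
    refine null_zero (F g) (hFc.comp (continuous_const.prodMk continuous_id))
      (fun i j => ((g : Matrix (Fin n) (Fin n) ℝ) * B) i j) ?_ ?_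
    · have : F g (fun i j => ((g : Matrix (Fin n) (Fin n) ℝ) * B) i j) = 1 := by
        show ((Matrix.transpose (g : Matrix (Fin n) (Fin n) ℝ) *
          ((g : Matrix (Fin n) (Fin n) ℝ) * B)).submatrix r c).det = 1
        rw [← Matrix.mul_assoc, hg, Matrix.one_mul]
        refine Eq.trans (congrArg Matrix.det ?_) (Matrix.det_one (n := Fin m) (R := ℝ))
        ext i j
        simp only [B, Matrix.submatrix_apply, Matrix.of_apply, Matrix.one_apply]
        congr 1
        apply propext
        constructor
        · rintro ⟨a, h1, h2⟩
          rw [← hr h1, hcinj h2]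
        · rintro rfl; exact ⟨i, rfl, rfl⟩
      rw [this]; exact one_ne_zero
    · intro X
      generalize (fun i j => ((g : Matrix (Fin n) (Fin n) ℝ) * B) i j) = Y
      let P : Matrix (Fin m) (Fin m) ℝ :=
        (Matrix.transpose (g : Matrix (Fin n) (Fin n) ℝ) * Matrix.of Y).submatrix r c
      let Q : Matrix (Fin m) (Fin m) ℝ :=
        (Matrix.transpose (g : Matrix (Fin n) (Fin n) ℝ) * Matrix.of X).submatrix r c
      refine ⟨(Matrix.of fun i j => Polynomial.C (P i j) + Polynomial.X * Polynomial.C (Q i j)).det, ?_⟩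
      intro t
      rw [← Polynomial.coe_evalRingHom, RingHom.map_det]
      show Matrix.det _ = _
      congr 1
      ext i j
      have e1 : (Polynomial.evalRingHom t).mapMatrix
          (Matrix.of fun i j => Polynomial.C (P i j) + Polynomial.X * Polynomial.C (Q i j)) i j =
          P i j + t * Q i j := by
        simp
        exact mul_comm _ _
      rw [e1]
      simp only [P, Q, Matrix.submatrix_apply, Matrix.mul_apply, Matrix.of_apply, Pi.add_apply,
        Pi.smul_apply, smul_eq_mul, mul_add, Finset.sum_add_distrib, Finset.mul_sum]
      congr 1
      exact Finset.sum_congr rfl fun _ _ => by ring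
  have e2 := Measure.measure_ae_null_of_prod_null (μ := (volume : Measure (Fin n → Fin n → ℝ))) (ν := H)
    (s := Prod.swap ⁻¹' T) (by
      rw [← Measure.prod_swap, Measure.map_apply measurable_swap (measurable_swap hT)]
      simpa [← Set.preimage_comp] using e1)
  obtain ⟨X, hX⟩ := e2.exists
  have hX : H {g | F g X = 0} = 0 := hX
  -- Gram-Schmidt
  let f : Fin n → EuclideanSpace ℝ (Fin n) := fun j => WithLp.toLp 2 fun i => X i j
  let b := InnerProductSpace.gramSchmidtOrthonormalBasis (𝕜 := ℝ) (E := EuclideanSpace ℝ (Fin n))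
    (by simp) f
  let q : OG n := ⟨_, og_orthonormal b b.orthonormal⟩
  have hXq : ∀ i j, X i j = ∑ l, (q : Matrix (Fin n) (Fin n) ℝ) i l * b.repr (f j) l := by
    intro i j
    have := congrArg (fun v : EuclideanSpace ℝ (Fin n) => v i) (b.sum_repr (f j))
    simp only [WithLp.ofLp_sum, Finset.sum_apply, PiLp.smul_apply, smul_eq_mul] at this
    rw [show X i j = f j i from rfl, ← this]
    exact Finset.sum_congr rfl fun _ _ => mul_comm _ _
  rw [ae_iff]
  simp only [ne_eq, not_not]
  rw [← measure_preimage_mul H q⁻¹]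
  refine measure_mono_null ?_ hX
  intro g hg
  simp only [Set.mem_preimage, Set.mem_ofPred_eq] at hg ⊢
  have hfac : (Matrix.transpose (g : Matrix (Fin n) (Fin n) ℝ) * Matrix.of X).submatrix r c =
      ((Matrix.transpose ((q⁻¹ * g : OG n) : Matrix (Fin n) (Fin n) ℝ)).submatrix r c) *
      (Matrix.of fun l j : Fin m => b.repr (f (c j)) (c l)) := by
    have h1 : Matrix.transpose ((q⁻¹ * g : OG n) : Matrix (Fin n) (Fin n) ℝ) =
        Matrix.transpose (g : Matrix (Fin n) (Fin n) ℝ) * (q : Matrix (Fin n) (Fin n) ℝ) := by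
      rw [og_mul_coe, og_inv_coe, Matrix.transpose_mul, Matrix.transpose_transpose]
    have h2 : Matrix.of X = (q : Matrix (Fin n) (Fin n) ℝ) * Matrix.of fun l j => b.repr (f j) l := by
      ext i j
      rw [Matrix.mul_apply]; exact hXq i j
    rw [h1, h2, ← Matrix.mul_assoc]
    generalize Matrix.transpose (g : Matrix (Fin n) (Fin n) ℝ) * (q : Matrix (Fin n) (Fin n) ℝ) = G
    ext i j
    simp only [Matrix.submatrix_apply, Matrix.mul_apply, Matrix.of_apply]
    symm
    rw [← Finset.sum_image (s := Finset.univ) (g := c) (f := fun l => G (r i) l * b.repr (f (c j)) l)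
      (fun _ _ _ _ h => hcinj h)]
    refine Finset.sum_subset (Finset.subset_univ _) ?_
    intro l _ hl
    have hjl : c j < l := by
      by_contra hcon
      apply hl
      rw [Finset.mem_image]
      have : (l : ℕ) ≤ j := by
        have := not_lt.1 hcon
        simpa [c, Fin.le_def] using this
      exact ⟨⟨l, lt_of_le_of_lt this j.2⟩, Finset.mem_univ _, rfl⟩
    rw [InnerProductSpace.gramSchmidtOrthonormalBasis_inv_triangular' _ f hjl, mul_zero]
  show ((Matrix.transpose (g : Matrix (Fin n) (Fin n) ℝ) * Matrix.of X).submatrix r c).det = 0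
  rw [hfac, Matrix.det_mul]
  have hg' : ((Matrix.transpose ((q⁻¹ * g : OG n) : Matrix (Fin n) (Fin n) ℝ)).submatrix r c).det = 0 := hg
  rw [hg', zero_mul]

lemma sphereHaus_ne_zero (m : ℕ) : sphereHaus m ≠ 0 := by
  let f : EuclideanSpace ℝ (Fin (m+1)) → (Fin m → ℝ) := fun x i => x i.castSucc
  have hf : LipschitzWith 1 f := by
    refine LipschitzWith.of_dist_le_mul fun x y => ?_
    rw [NNReal.coe_one, one_mul, dist_pi_le_iff dist_nonneg]
    intro i
    have := PiLp.norm_apply_le (x - y) i.castSucc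
    simpa [f, dist_eq_norm] using this
  have h1 := hf.hausdorffMeasure_image_le (d := (m:ℝ)) (by positivity)
    (Metric.sphere (0 : EuclideanSpace ℝ (Fin (m+1))) 1)
  have hvol : (μH[(m:ℝ)] : Measure (Fin m → ℝ)) = volume := by
    have := hausdorffMeasure_pi_real (ι := Fin m)
    simpa using this
  intro h0
  have h0' : μH[(m:ℝ)] (Metric.sphere (0 : EuclideanSpace ℝ (Fin (m+1))) 1) = 0 := h0
  rw [h0', mul_zero, hvol] at h1
  let U : Set (Fin m → ℝ) := {y | ∑ i, y i ^ 2 < 1}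
  have hU : IsOpen U := isOpen_lt (by fun_prop) continuous_const
  have hsub : U ⊆ f '' Metric.sphere 0 1 := by
    intro y hy
    refine ⟨WithLp.toLp 2 (Fin.snoc y (√(1 - ∑ i, y i ^ 2)) : Fin (m+1) → ℝ), ?_, ?_⟩
    · rw [mem_sphere_iff_norm, sub_zero, EuclideanSpace.norm_eq]
      rw [Real.sqrt_eq_one, Fin.sum_univ_castSucc]
      have hy' : ∑ i, y i ^ 2 < 1 := hy
      simp only [Fin.snoc_castSucc, Fin.snoc_last, Real.norm_eq_abs, sq_abs]
      rw [Real.sq_sqrt (by linarith)]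
      ring
    · ext i
      simp [f]
  have : 0 < volume U := hU.measure_pos _ ⟨0, by simp [U]⟩
  exact absurd (lt_of_lt_of_le this ((measure_mono hsub).trans h1)) (lt_irrefl _)

lemma sphereHaus_ne_top (m : ℕ) : sphereHaus m ≠ ⊤ := by
  have hvol : (μH[(m:ℝ)] : Measure (Fin m → ℝ)) = volume := by
    have := hausdorffMeasure_pi_real (ι := Fin m)
    simpa using this
  let e : Fin (m+1) → ℝ → (Fin m → ℝ) → EuclideanSpace ℝ (Fin (m+1)) := fun i s y =>
    WithLp.toLp 2 (i.insertNth s y : Fin (m+1) → ℝ)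
  let f : Fin (m+1) → ℝ → (Fin m → ℝ) → EuclideanSpace ℝ (Fin (m+1)) := fun i s y =>
    ‖e i s y‖⁻¹ • e i s y
  let Q : Set (Fin m → ℝ) := Set.Icc (-1) 1
  have key : ∀ i s, s ≠ 0 → μH[(m:ℝ)] (f i s '' Q) < ⊤ := by
    intro i s hs
    have he : ContDiff ℝ 1 (e i s) := by
      rw [contDiff_euclidean]
      intro j
      refine Fin.succAboveCases i ?_ (fun j => ?_) j
      · simpa [e] using contDiff_const
      · simpa [e] using contDiff_apply ℝ ℝ j
    have hne : ∀ y, e i s y ≠ 0 := by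
      intro y h
      have := congrArg (fun v : EuclideanSpace ℝ (Fin (m+1)) => v i) h
      simp [e] at this
      exact hs this
    have hfd : ContDiff ℝ 1 (f i s) :=
      ((he.norm ℝ hne).inv (fun y => norm_ne_zero_iff.2 (hne y))).smul he
    obtain ⟨K, hK⟩ := hfd.contDiffOn.exists_lipschitzOnWith (s := Q) one_ne_zero (convex_Icc _ _) isCompact_Icc
    refine lt_of_le_of_lt (hK.hausdorffMeasure_image_le (d := (m:ℝ)) (by positivity)) ?_
    rw [hvol]
    refine ENNReal.mul_lt_top (ENNReal.rpow_lt_top_of_nonneg (by positivity) ENNReal.coe_ne_top) ?_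
    exact isCompact_Icc.measure_lt_top
  have hcov : Metric.sphere (0 : EuclideanSpace ℝ (Fin (m+1))) 1 ⊆
      ⋃ i : Fin (m+1), (f i 1 '' Q ∪ f i (-1) '' Q) := by
    intro x hx
    rw [mem_sphere_iff_norm, sub_zero] at hx
    obtain ⟨i, hi⟩ := Finite.exists_max fun j => |x j|
    have hxi : x i ≠ 0 := by
      intro h
      have : x = 0 := by
        ext j
        have := hi j
        rw [h, abs_zero] at this
        simpa using abs_nonpos_iff.1 this
      rw [this, norm_zero] at hx
      exact zero_ne_one hx
    have hpos : 0 < |x i| := abs_pos.2 hxi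
    have hQ : (fun j : Fin m => |x i|⁻¹ * x (i.succAbove j)) ∈ Q := by
      have : ∀ j : Fin m, |(|x i|⁻¹ * x (i.succAbove j))| ≤ 1 := by
        intro j
        rw [abs_mul, abs_inv, abs_abs, inv_mul_le_iff₀ hpos, mul_one]
        exact hi _
      exact ⟨fun j => (abs_le.1 (this j)).1, fun j => (abs_le.1 (this j)).2⟩
    have he : ∀ s, s = |x i|⁻¹ * x i → f i s (fun j : Fin m => |x i|⁻¹ * x (i.succAbove j)) = x := by
      intro s hs
      have : e i s (fun j : Fin m => |x i|⁻¹ * x (i.succAbove j)) = |x i|⁻¹ • x := by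
        ext j
        refine Fin.succAboveCases i ?_ (fun j => ?_) j
        · simp [e, hs]
        · simp [e]
      simp only [f, this]
      rw [norm_smul, hx, norm_inv, Real.norm_eq_abs, abs_abs, mul_one, inv_inv, smul_smul,
        mul_inv_cancel₀ hpos.ne', one_smul]
    refine Set.mem_iUnion.2 ⟨i, ?_⟩
    rcases lt_or_gt_of_ne hxi with h | h
    · right
      refine ⟨_, hQ, he _ ?_⟩
      rw [abs_of_neg h]; field_simp
    · left
      refine ⟨_, hQ, he _ ?_⟩
      rw [abs_of_pos h]; field_simp
  have : μH[(m:ℝ)] (Metric.sphere (0 : EuclideanSpace ℝ (Fin (m+1))) 1) < ⊤ := by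
    refine lt_of_le_of_lt (measure_mono hcov) ?_
    refine lt_of_le_of_lt (measure_iUnion_fintype_le _ _) ?_
    refine ENNReal.sum_lt_top.2 fun i _ => ?_
    refine lt_of_le_of_lt (measure_union_le _ _) ?_
    exact ENNReal.add_lt_top.2 ⟨key i 1 one_ne_zero, key i (-1) (by norm_num)⟩
  exact this.ne

/-- isometric embedding matrix onto the span of the face -/
def matM (m k : ℕ) : Matrix (Fin (m+k)) (Fin (m+1)) ℝ := Matrix.of fun i b =>
  Fin.addCases (motive := fun _ => ℝ) (fun j => if b = j.castSucc then 1 else 0)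
    (fun _ => if b = Fin.last m then (√(k:ℝ))⁻¹ else 0) i

def embM (m k : ℕ) : EuclideanSpace ℝ (Fin (m+1)) →ₗ[ℝ] EuclideanSpace ℝ (Fin (m+k)) :=
  Matrix.toEuclideanLin (matM m k)

lemma embM_left {m k : ℕ} (y : EuclideanSpace ℝ (Fin (m+1))) (j : Fin m) :
    embM m k y (Fin.castAdd k j) = y j.castSucc := by
  simp [embM, Matrix.toLpLin_apply, Matrix.mulVec, dotProduct, matM]

lemma embM_right {m k : ℕ} (y : EuclideanSpace ℝ (Fin (m+1))) (j : Fin k) :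
    embM m k y (Fin.natAdd m j) = (√(k:ℝ))⁻¹ * y (Fin.last m) := by
  simp [embM, Matrix.toLpLin_apply, Matrix.mulVec, dotProduct, matM]

lemma embM_norm {m k : ℕ} (hk : 1 ≤ k) (y : EuclideanSpace ℝ (Fin (m+1))) :
    ‖embM m k y‖ = ‖y‖ := by
  have hk0 : (0:ℝ) < k := by exact_mod_cast hk
  rw [← sq_eq_sq₀ (norm_nonneg _) (norm_nonneg _), EuclideanSpace.real_norm_sq_eq,
    EuclideanSpace.real_norm_sq_eq, Fin.sum_univ_add, Fin.sum_univ_castSucc]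
  simp only [embM_left, embM_right]
  simp only [Finset.sum_const, Finset.card_univ, Fintype.card_fin, nsmul_eq_mul]
  rw [mul_pow, inv_pow, Real.sq_sqrt hk0.le]
  field_simp

lemma matM_orth {m k : ℕ} (hk : 1 ≤ k) : Matrix.transpose (matM m k) * matM m k = 1 := by
  have hk0 : (0:ℝ) < k := by exact_mod_cast hk
  ext a b
  rw [Matrix.mul_apply, Fin.sum_univ_add, Matrix.one_apply]
  simp only [Matrix.transpose_apply, matM, Matrix.of_apply, Fin.addCases_left, Fin.addCases_right]
  have hs : (√(k:ℝ))⁻¹ * (√(k:ℝ))⁻¹ = (k:ℝ)⁻¹ := by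
    rw [← mul_inv, Real.mul_self_sqrt hk0.le]
  refine Fin.lastCases ?_ (fun a => ?_) a <;> refine Fin.lastCases ?_ (fun b => ?_) b
  · have : ∀ x : Fin m, Fin.last m ≠ x.castSucc := fun x => (Fin.castSucc_lt_last x).ne'
    simp [this, hs, hk0.ne']
  · have : ∀ x : Fin m, Fin.last m ≠ x.castSucc := fun x => (Fin.castSucc_lt_last x).ne'
    simp [this, (Fin.castSucc_lt_last _).ne]
  · have : ∀ x : Fin m, Fin.last m ≠ x.castSucc := fun x => (Fin.castSucc_lt_last x).ne'
    simp [this, (Fin.castSucc_lt_last _).ne]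
  · simp [(Fin.castSucc_lt_last _).ne, eq_comm]

lemma exists_iota {m k : ℕ} (hk : 1 ≤ k) (h : OG (m+1)) :
    ∃ u : OG (m+k), ∀ y, act u (embM m k y) = embM m k (act h y) := by
  let M := matM m k
  have hM : Matrix.transpose M * M = 1 := matM_orth hk
  have hh : (h : Matrix (Fin (m+1)) (Fin (m+1)) ℝ) * Matrix.transpose (h : Matrix (Fin (m+1)) (Fin (m+1)) ℝ) = 1 :=
    (Matrix.mem_orthogonalGroup_iff _ _).1 h.2
  generalize hB : (h : Matrix (Fin (m+1)) (Fin (m+1)) ℝ) = B at hh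
  have hM' : ∀ {p : ℕ} (X : Matrix (Fin (m+1)) (Fin p) ℝ), Matrix.transpose M * (M * X) = X := by
    intro p X
    rw [← Matrix.mul_assoc, hM, Matrix.one_mul]
  have hh' : ∀ {p : ℕ} (X : Matrix (Fin (m+1)) (Fin p) ℝ), B * (Matrix.transpose B * X) = X := by
    intro p X
    rw [← Matrix.mul_assoc, hh, Matrix.one_mul]
  let U : Matrix (Fin (m+k)) (Fin (m+k)) ℝ := M * B * Matrix.transpose M + 1 - M * Matrix.transpose M
  have hU : U ∈ Matrix.orthogonalGroup (Fin (m+k)) ℝ := by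
    rw [Matrix.mem_orthogonalGroup_iff]
    simp only [U, Matrix.transpose_add, Matrix.transpose_sub, Matrix.transpose_mul,
      Matrix.transpose_transpose, Matrix.transpose_one, Matrix.mul_add, Matrix.add_mul,
      Matrix.mul_sub, Matrix.sub_mul, Matrix.mul_assoc, hM', hh', Matrix.mul_one, Matrix.one_mul]
    abel
  have hUM : U * M = M * B := by
    simp only [U, Matrix.add_mul, Matrix.sub_mul, Matrix.mul_assoc, hM, Matrix.mul_one, Matrix.one_mul]
    abel
  refine ⟨⟨U, hU⟩, fun y => ?_⟩
  simp only [act, embM, Matrix.toLpLin_apply, hB, Matrix.mulVec_mulVec]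
  rw [show U * matM m k = matM m k * B from hUM]

/-- preimage of the cap -/
def capA (m k : ℕ) : Set (EuclideanSpace ℝ (Fin (m+1))) :=
  {y | ‖y‖ = 1 ∧ ∀ j : Fin m, |y j.castSucc| ≤ (√(k:ℝ))⁻¹ * y (Fin.last m)}

lemma capA_compact (m k : ℕ) : IsCompact (capA m k) := by
  refine IsCompact.of_isClosed_subset (isCompact_sphere (0 : EuclideanSpace ℝ (Fin (m+1))) 1) ?_ ?_
  · have : capA m k = {y | ‖y‖ = 1} ∩
        ⋂ j : Fin m, {y | |y j.castSucc| ≤ (√(k:ℝ))⁻¹ * y (Fin.last m)} := by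
      ext y; simp [capA]
    rw [this]
    refine (isClosed_eq continuous_norm continuous_const).inter (isClosed_iInter fun j => ?_)
    exact isClosed_le (by fun_prop) (by fun_prop)
  · intro y hy
    simpa using hy.1

lemma capA_last_pos {m k : ℕ} [NeZero m] (hk : 1 ≤ k) {y : EuclideanSpace ℝ (Fin (m+1))} (hy : y ∈ capA m k) :
    0 < y (Fin.last m) := by
  have hk0 : (0:ℝ) < (√(k:ℝ))⁻¹ := by
    have : (0:ℝ) < k := by exact_mod_cast hk
    positivity
  by_contra hcon
  push Not at hcon
  have hz : ∀ j : Fin m, y j.castSucc = 0 := fun j => by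
    have := hy.2 j
    have h2 : (√(k:ℝ))⁻¹ * y (Fin.last m) ≤ 0 := mul_nonpos_of_nonneg_of_nonpos hk0.le hcon
    exact abs_nonpos_iff.1 (this.trans h2)
  have h0 := (abs_nonneg _).trans (hy.2 0)
  have hl : y (Fin.last m) = 0 := le_antisymm hcon (nonneg_of_mul_nonneg_right h0 hk0)
  have hy0 : y = 0 := by
    ext j
    refine Fin.lastCases ?_ (fun j => ?_) j
    · simpa using hl
    · simpa using hz j
  have := hy.1
  rw [hy0, norm_zero] at this
  exact zero_ne_one this

lemma cone_eq {m k : ℕ} [NeZero m] (hk : 1 ≤ k) :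
    coneSphere (cubeFace (m+k) m) = embM m k '' capA m k := by
  have hk0 : (0:ℝ) < √(k:ℝ) := by
    have : (0:ℝ) < k := by exact_mod_cast hk
    positivity
  ext x
  constructor
  · rintro ⟨⟨z, ⟨hz1, hz2⟩, t, ht, rfl⟩, hx⟩
    let y : EuclideanSpace ℝ (Fin (m+1)) :=
      WithLp.toLp 2 (Fin.snoc (fun j => t * z (Fin.castAdd k j)) (t * √k) : Fin (m+1) → ℝ)
    have hy : embM m k y = t • z := by
      ext i
      refine Fin.addCases (fun j => ?_) (fun j => ?_) i
      · rw [embM_left]; simp [y]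
      · rw [embM_right, PiLp.smul_apply, hz2 _ (by simp)]; simp [y]; field_simp
    refine ⟨y, ⟨?_, fun j => ?_⟩, hy⟩
    · rw [← embM_norm hk, hy]; simpa using hx
    · have := hz1 (Fin.castAdd k j) (by simp)
      simp only [y, Fin.snoc_castSucc, Fin.snoc_last, abs_mul, abs_of_nonneg ht]
      calc t * |z (Fin.castAdd k j)| ≤ t * 1 := mul_le_mul_of_nonneg_left this ht
        _ = _ := by field_simp
  · rintro ⟨y, hy, rfl⟩
    have hl := capA_last_pos hk hy
    let t : ℝ := (√(k:ℝ))⁻¹ * y (Fin.last m)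
    have ht : 0 < t := by positivity
    refine ⟨⟨t⁻¹ • embM m k y, ⟨?_, ?_⟩, t, ht.le, ?_⟩, ?_⟩
    · intro i
      refine Fin.addCases (fun j _ => ?_) (fun j hj => ?_) i
      · rw [PiLp.smul_apply, embM_left, smul_eq_mul, abs_mul, abs_inv, abs_of_pos ht,
          inv_mul_le_iff₀ ht, mul_one]
        exact hy.2 j
      · simp at hj
    · intro i
      refine Fin.addCases (fun j hj => ?_) (fun j hj => ?_) i
      · simp at hj
        omega
      · rw [PiLp.smul_apply, embM_right, smul_eq_mul]
        exact inv_mul_cancel₀ ht.ne'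
    · rw [smul_smul, mul_inv_cancel₀ ht.ne', one_smul]
    · simpa [embM_norm hk] using hy.1

lemma Ek_smul {n k : ℕ} {x : EuclideanSpace ℝ (Fin n)} (hx : x ∈ Ek n k) (t : ℝ) :
    t • x ∈ Ek n k := fun i hi => by
  rw [PiLp.smul_apply, hx i hi, smul_zero]

lemma event_iff {m k : ℕ} [NeZero m] (hk : 1 ≤ k) (g : OG (m+k)) :
    (act g '' Ek (m+k) k ∩ cubeFace (m+k) m).Nonempty ↔
      ∃ y ∈ capA m k, act g⁻¹ (embM m k y) ∈ Ek (m+k) k := by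
  constructor
  · rintro ⟨_, ⟨e, he, rfl⟩, hz⟩
    have hne : act g e ≠ 0 := by
      intro h0
      have := hz.2 (Fin.natAdd m ⟨0, hk⟩) (by simp)
      rw [h0] at this
      simp at this
    have hn : 0 < ‖act g e‖ := norm_pos_iff.2 hne
    have : ‖act g e‖⁻¹ • act g e ∈ coneSphere (cubeFace (m+k) m) := by
      refine ⟨⟨_, hz, _, (inv_pos.2 hn).le, rfl⟩, ?_⟩
      rw [mem_sphere_iff_norm, sub_zero, norm_smul, norm_inv, norm_norm, inv_mul_cancel₀ hn.ne']
    rw [cone_eq hk] at this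
    obtain ⟨y, hy, hye⟩ := this
    refine ⟨y, hy, ?_⟩
    rw [hye, act_smul, act_inv_act]
    exact Ek_smul he _
  · rintro ⟨y, hy, hyE⟩
    have : embM m k y ∈ coneSphere (cubeFace (m+k) m) := by
      rw [cone_eq hk]; exact ⟨y, hy, rfl⟩
    obtain ⟨⟨z, hz, t, ht, htz⟩, hs⟩ := this
    have ht0 : t ≠ 0 := by
      rintro rfl
      rw [zero_smul] at htz
      rw [htz] at hs
      simp at hs
    refine ⟨z, ⟨act g⁻¹ z, ?_, act_act_inv g z⟩, hz⟩
    have : z = t⁻¹ • embM m k y := by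
      rw [htz, smul_smul, inv_mul_cancel₀ ht0, one_smul]
    rw [this, act_smul]
    exact Ek_smul hyE _

/-- the last `m` rows -/
def rowR (m k : ℕ) : Fin m → Fin (m+k) := fun i => ⟨k + i, by omega⟩

lemma mem_Ek_iff {m k : ℕ} (x : EuclideanSpace ℝ (Fin (m+k))) :
    x ∈ Ek (m+k) k ↔ ∀ i, x (rowR m k i) = 0 := by
  constructor
  · intro h i; exact h _ (by simp [rowR])
  · intro h i hi
    have := h ⟨i - k, by omega⟩
    have e : rowR m k ⟨i - k, by omega⟩ = i := by
      ext; simp [rowR]; omega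
    rwa [e] at this

lemma line_lemma {m k : ℕ} (g : OG (m+k))
    (hg : ((Matrix.transpose (g : Matrix (Fin (m+k)) (Fin (m+k)) ℝ)).submatrix (rowR m k)
      (Fin.castLE (Nat.le_add_right m k))).det ≠ 0) :
    ∃ v : EuclideanSpace ℝ (Fin (m+1)), ‖v‖ = 1 ∧ ∀ y : EuclideanSpace ℝ (Fin (m+1)), ‖y‖ = 1 →
      (act g⁻¹ (embM m k y) ∈ Ek (m+k) k ↔ y = v ∨ y = -v) := by
  let L : EuclideanSpace ℝ (Fin (m+1)) →ₗ[ℝ] (Fin m → ℝ) :=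
    { toFun := fun y i => act g⁻¹ (embM m k y) (rowR m k i)
      map_add' := fun x y => by ext i; simp [act]
      map_smul' := fun t x => by ext i; simp [act] }
  have hL : ∀ y, act g⁻¹ (embM m k y) ∈ Ek (m+k) k ↔ L y = 0 := by
    intro y
    rw [mem_Ek_iff, funext_iff]; rfl
  have hinj : ∀ y, L y = 0 → y (Fin.last m) = 0 → y = 0 := by
    intro y hy hl
    have h1 : Matrix.mulVec ((Matrix.transpose (g : Matrix (Fin (m+k)) (Fin (m+k)) ℝ)).submatrix (rowR m k)
      (Fin.castLE (Nat.le_add_right m k))) (fun j => y j.castSucc) = 0 := by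
      ext i
      have := congrFun hy i
      change act g⁻¹ (embM m k y) (rowR m k i) = 0 at this
      rw [act_apply, Fin.sum_univ_add] at this
      simp only [embM_left, embM_right, hl, mul_zero, Finset.sum_const_zero, add_zero] at this
      exact this
    have h2 := Matrix.eq_zero_of_mulVec_eq_zero hg h1
    ext j
    refine Fin.lastCases ?_ (fun j => ?_) j
    · simpa using hl
    · simpa using congrFun h2 j
  have hker : LinearMap.ker L ≠ ⊥ := LinearMap.ker_ne_bot_of_finrank_lt (by simp)
  obtain ⟨w, hw, hw0⟩ := Submodule.exists_mem_ne_zero_of_ne_bot hker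
  have hw : L w = 0 := hw
  have hn : 0 < ‖w‖ := norm_pos_iff.2 hw0
  have hwl : w (Fin.last m) ≠ 0 := fun h => hw0 (hinj w hw h)
  let v := ‖w‖⁻¹ • w
  have hv1 : ‖v‖ = 1 := by
    rw [norm_smul, norm_inv, norm_norm, inv_mul_cancel₀ hn.ne']
  have hLv : L v = 0 := by rw [map_smul, hw, smul_zero]
  have hvl : v (Fin.last m) ≠ 0 := by
    simp only [v, PiLp.smul_apply, smul_eq_mul]
    positivity
  refine ⟨v, hv1, fun y hy => ?_⟩
  rw [hL]
  constructor
  · intro hLy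
    have hz := hinj (y - (y (Fin.last m) / v (Fin.last m)) • v)
      (by rw [map_sub, map_smul, hLy, hLv, smul_zero, sub_zero])
      (by simp [hvl])
    rw [sub_eq_zero] at hz
    generalize y (Fin.last m) / v (Fin.last m) = t at hz
    have ht : |t| = 1 := by
      have := congrArg norm hz
      rw [hy, norm_smul, hv1, mul_one, Real.norm_eq_abs] at this
      exact this.symm
    rcases eq_or_eq_neg_of_abs_eq ht with rfl | rfl
    · left; rw [hz, one_smul]
    · right; rw [hz, neg_smul, one_smul]
  · rintro (rfl | rfl)
    · exact hLv
    · rw [map_neg, hLv, neg_zero]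

lemma core {m k : ℕ} [NeZero m] (hk : 1 ≤ k)
    (H : Measure (OG (m+k))) [H.IsHaarMeasure] [IsProbabilityMeasure H] :
    H {g | (act g '' Ek (m+k) k ∩ cubeFace (m+k) m).Nonempty} =
      2 * sigmaMeas m (coneSphere (cubeFace (m+k) m)) := by
  let A := capA m k
  have hAc : IsCompact A := capA_compact m k
  have hAm : MeasurableSet A := hAc.isClosed.measurableSet
  have hAS : A ⊆ Metric.sphere 0 1 := fun y hy => by simpa using hy.1
  obtain ⟨κ, hκ1, hκ2⟩ : ∃ κ : Measure (OG (m+1)), κ.IsMulLeftInvariant ∧ IsProbabilityMeasure κ :=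
    ⟨Measure.haarMeasure ⊤, inferInstance, ⟨Measure.haarMeasure_self (K₀ := ⊤)⟩⟩
  have hσ : sigmaMeas m (coneSphere (cubeFace (m+k) m)) = μH[(m:ℝ)] A / sphereHaus m := by
    rw [sigmaMeas, cone_eq hk]
    congr 1
    refine Isometry.hausdorffMeasure_image ?_ (Or.inl (by positivity)) _
    exact AddMonoidHomClass.isometry_of_norm _ (embM_norm hk)
  have hu : ∀ v : EuclideanSpace ℝ (Fin (m+1)), ‖v‖ = 1 →
      κ {h | act h⁻¹ v ∈ A} = μH[(m:ℝ)] A / sphereHaus m := by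
    intro v hv
    rw [← unif κ (sphereHaus_ne_top m) A hAm hAS v hv,
      ENNReal.mul_div_cancel_right (sphereHaus_ne_zero m) (sphereHaus_ne_top m)]
  let S : Set (OG (m+k)) := {g | ∃ y ∈ A, act g⁻¹ (embM m k y) ∈ Ek (m+k) k}
  have hS : {g | (act g '' Ek (m+k) k ∩ cubeFace (m+k) m).Nonempty} = S := by
    ext g; exact event_iff hk g
  let D : Set (OG (m+k) × OG (m+1)) :=
    {p | ∃ y ∈ A, act p.1⁻¹ (embM m k (act p.2 y)) ∈ Ek (m+k) k}
  have hEc : IsClosed (Ek (m+k) k) := by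
    have : Ek (m+k) k = ⋂ i : Fin m, {x | x (rowR m k i) = 0} := by
      ext x; rw [mem_Ek_iff]; simp
    rw [this]
    exact isClosed_iInter fun i => isClosed_eq (by fun_prop) continuous_const
  have hD : IsClosed D := by
    have : CompactSpace A := isCompact_iff_compactSpace.1 hAc
    let f : A × (OG (m+k) × OG (m+1)) → EuclideanSpace ℝ (Fin (m+k)) :=
      fun q => act q.2.1⁻¹ (embM m k (act q.2.2 q.1))
    have hf : Continuous f := by
      refine act_continuous_comp ((og_continuous_inv _).comp (continuous_fst.comp continuous_snd)) ?_
      refine (LinearMap.continuous_of_finiteDimensional (embM m k)).comp ?_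
      exact act_continuous_comp (continuous_snd.comp continuous_snd)
        (continuous_subtype_val.comp continuous_fst)
    have h1 : D = Prod.snd '' (f ⁻¹' Ek (m+k) k) := by
      ext p
      constructor
      · rintro ⟨y, hy, h⟩
        exact ⟨(⟨y, hy⟩, p), h, rfl⟩
      · rintro ⟨⟨⟨y, hy⟩, p⟩, h, rfl⟩
        exact ⟨y, hy, h⟩
    rw [h1]
    exact isClosedMap_snd_of_compactSpace _ (hEc.preimage hf)
  have hDm : MeasurableSet D := hD.measurableSet
  have e1 : (H.prod κ) D = H S := by
    rw [Measure.prod_apply_symm hDm]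
    have : ∀ h : OG (m+1), H ((fun g => (g, h)) ⁻¹' D) = H S := by
      intro h
      obtain ⟨u, hu⟩ := exists_iota (m := m) hk h
      rw [← measure_preimage_mul H u⁻¹ S]
      congr 1
      ext g
      simp only [D, S, Set.mem_preimage, Set.mem_ofPred_eq, mul_inv_rev, inv_inv, act_mul, hu]
    simp [this]
  have e2 : (H.prod κ) D = 2 * (μH[(m:ℝ)] A / sphereHaus m) := by
    rw [Measure.prod_apply hDm]
    have hae : ∀ᵐ g : OG (m+k) ∂H, κ (Prod.mk g ⁻¹' D) = 2 * (μH[(m:ℝ)] A / sphereHaus m) := by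
      filter_upwards [og_det_ae (Nat.le_add_right m k) H (rowR m k)
        (fun a b h => by simpa [rowR, Fin.ext_iff] using h)] with g hg
      obtain ⟨v, hv, hvy⟩ := line_lemma g hg
      have hset : Prod.mk g ⁻¹' D = {h | act h⁻¹ v ∈ A} ∪ {h | act h⁻¹ (-v) ∈ A} := by
        ext h
        simp only [D, Set.mem_preimage, Set.mem_ofPred_eq, Set.mem_union]
        constructor
        · rintro ⟨y, hy, hE⟩
          rcases (hvy _ (by rw [act_norm]; exact hy.1)).1 hE with h1 | h1
          · left; rwa [← h1, act_inv_act]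
          · right; rwa [← h1, act_inv_act]
        · rintro (h1 | h1)
          · exact ⟨_, h1, by rw [act_act_inv]; exact (hvy v hv).2 (Or.inl rfl)⟩
          · exact ⟨_, h1, by
              rw [act_act_inv]; exact (hvy (-v) (by rw [norm_neg, hv])).2 (Or.inr rfl)⟩
      rw [hset, measure_union, hu v hv, hu (-v) (by rw [norm_neg, hv]), two_mul]
      · rw [Set.disjoint_left]
        intro h h1 h2
        have p1 := capA_last_pos hk h1
        have p2 := capA_last_pos hk h2
        rw [act_neg, PiLp.neg_apply] at p2
        linarith
      · exact (act_continuous_comp (og_continuous_inv _) continuous_const).measurable hAm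
    rw [lintegral_congr_ae hae]
    simp
  rw [hS, hσ, ← e1, e2]

/-- `Prob{X ∩ F_{n-k} ≠ ∅} = 2 σ_{n-k}(C₁(F_{n-k}))`. -/
theorem prob_section_meets_face (n k : ℕ) (hk : 1 ≤ k) (hkn : k < n)
    (H : Measure (OG n)) [H.IsHaarMeasure] [IsProbabilityMeasure H] :
    H {g | (act g '' Ek n k ∩ cubeFace n (n - k)).Nonempty} =
      2 * sigmaMeas (n - k) (coneSphere (cubeFace n (n - k))) := by
  obtain ⟨m, rfl⟩ : ∃ m, n = m + k := ⟨n - k, by omega⟩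
  have : NeZero m := ⟨by omega⟩
  rw [Nat.add_sub_cancel]
  exact core hk H
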